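/- Let G be a network (a finite, strongly connected directed multigraph without self-loops) with a routing scheme, let ≤ be a linear order on E that respects the routing scheme, let E_s be the set of the s smallest edges for some 1 ≤ s ≤ |E|, and let R be the set of global attractors of the subgraph G_s = (V, E_s). Partition E_s into C₂ = {e ∈ E_s : src e ∈ R and tgt e ∈ R} and C₁ = E_s \ C₂. Then there exists a linear order ≤' on E that respects the routing scheme, agrees with ≤ on all edges outside E_s and keeps those edges above all edges of E_s, has E_s as its set of s smallest edges, places every edge of C₁ below every edge of C₂, and preserves the relative ≤-order within C₁ and within C₂. -/

import Mathlib

/-- `p` is a directed path from `u` to `w` in the directed multigraph given by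
`src, tgt : E → V`: a nonempty list of edges where the target of each edge equals the
source of the next, starting at `u` and ending at `w`. -/
def IsPathFrom {V E : Type*} (src tgt : E → V) (u w : V) (p : List E) : Prop :=
  p ≠ [] ∧ p.Chain' (fun e₁ e₂ => tgt e₁ = src e₂) ∧
    p.head?.map src = some u ∧ p.getLast?.map tgt = some w

/-- `w` is reachable from `u` by a directed path using only edges from `A`. -/
def ReachableVia {V E : Type*} (src tgt : E → V) (A : Set E) (u w : V) : Prop :=
  ∃ p : List E, (∀ e ∈ p, e ∈ A) ∧ IsPathFrom src tgt u w p

/-- The graph is strongly connected: every vertex reaches every other vertex. -/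
def StronglyConnected {V E : Type*} (src tgt : E → V) : Prop :=
  ∀ u w : V, u ≠ w → ReachableVia src tgt Set.univ u w

/-- `route` is a routing scheme: it assigns to every ordered pair of distinct vertices
a directed path between them. -/
def IsRouting {V E : Type*} (src tgt : E → V) (route : ∀ u w : V, u ≠ w → List E) : Prop :=
  ∀ (u w : V) (h : u ≠ w), IsPathFrom src tgt u w (route u w h)

/-- The dependency relation of a routing scheme: `Dep route e₁ e₂` iff `e₂` immediately
follows `e₁` on some routing path. -/
def Dep {V E : Type*} (route : ∀ u w : V, u ≠ w → List E) (e₁ e₂ : E) : Prop :=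
  ∃ (u w : V) (h : u ≠ w), [e₁, e₂] <:+: route u w h

/-- A routing scheme is deadlock-free iff its dependency relation is acyclic. -/
def DeadlockFree {V E : Type*} (route : ∀ u w : V, u ≠ w → List E) : Prop :=
  Irreflexive (Relation.TransGen (Dep route))

/-- `T` is a spanning in-tree rooted at `v`: it has exactly `|V| - 1` edges and every
vertex other than `v` has a directed path to `v` using only edges of `T`. -/
def IsInTree {V E : Type*} [Fintype V] (src tgt : E → V) (v : V) (T : Finset E) : Prop :=
  T.card = Fintype.card V - 1 ∧ ∀ u : V, u ≠ v → ReachableVia src tgt ↑T u v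

/-- `T` is a spanning out-tree rooted at `v`: it has exactly `|V| - 1` edges and every
vertex other than `v` is reachable from `v` by a directed path using only edges of `T`. -/
def IsOutTree {V E : Type*} [Fintype V] (src tgt : E → V) (v : V) (T : Finset E) : Prop :=
  T.card = Fintype.card V - 1 ∧ ∀ w : V, w ≠ v → ReachableVia src tgt ↑T v w

/-- A linear order on `E` respects a routing scheme if `e₁ < e₂` whenever `e₂`
immediately follows `e₁` on some routing path. -/
def RespectsRouting {V E : Type*} (route : ∀ u w : V, u ≠ w → List E)
    (ord : LinearOrder E) : Prop :=
  ∀ e₁ e₂ : E, Dep route e₁ e₂ → ord.lt e₁ e₂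

/-- The set of the `s` smallest edges of a linear order on `E`. -/
def smallestEdges {E : Type*} (ord : LinearOrder E) (s : ℕ) : Set E :=
  {e | {e' | ord.le e' e}.ncard ≤ s}

/-- `v` is a global attractor of the subgraph with edge set `A`: it is reachable from
every other vertex by a directed path using only edges of `A`. -/
def IsGlobalAttractor {V E : Type*} (src tgt : E → V) (A : Set E) (v : V) : Prop :=
  ∀ u : V, u ≠ v → ReachableVia src tgt A u v

/-- The attraction number of a linear order on `E`: the least `s` such that the subgraph
consisting of the `s` smallest edges has a global attractor. -/
noncomputable def attractionNumber {V E : Type*} (src tgt : E → V) (ord : LinearOrder E) : ℕ :=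
  sInf {s | ∃ v : V, IsGlobalAttractor src tgt (smallestEdges ord s) v}

theorem mem_smallestEdges_of_le {E : Type*} [Finite E] (ord : LinearOrder E) {s : ℕ} {a b : E}
    (hab : ord.le a b) (hb : b ∈ smallestEdges ord s) : a ∈ smallestEdges ord s :=
  (Set.ncard_le_ncard (fun _ hx => ord.le_trans _ _ _ hx hab) (Set.toFinite _)).trans hb

theorem ncard_smallestEdges {E : Type*} [Fintype E] (ord : LinearOrder E) {s : ℕ}
    (hs : s ≤ Fintype.card E) : (smallestEdges ord s).ncard = s := by
  apply le_antisymm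
  · rcases (smallestEdges ord s).eq_empty_or_nonempty with h | h
    · simp [h]
    · obtain ⟨m, hm, hmax⟩ := (Set.toFinite (smallestEdges ord s)).exists_maximal h
      refine (Set.ncard_le_ncard (fun x hx => ?_) (Set.toFinite _)).trans
        (show {x | ord.le x m}.ncard ≤ s from hm)
      exact (ord.le_total x m).elim id fun h => hmax hx h
  · rcases (smallestEdges ord s)ᶜ.eq_empty_or_nonempty with h | h
    · rw [Set.compl_empty_iff.mp h, Set.ncard_univ, Nat.card_eq_fintype_card]
      exact hs
    · obtain ⟨m, hm, hmin⟩ := (Set.toFinite (smallestEdges ord s)ᶜ).exists_minimal h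
      have hlt : s < {x | ord.le x m}.ncard := not_le.mp hm
      have hsub : {x | ord.le x m} ⊆ insert m (smallestEdges ord s) := by
        intro x hx
        by_cases hxs : x ∈ smallestEdges ord s
        · exact Or.inr hxs
        · exact Or.inl (ord.le_antisymm _ _ hx (hmin hxs hx))
      have := Set.ncard_le_ncard hsub (Set.toFinite _)
      have := Set.ncard_insert_le m (smallestEdges ord s)
      omega

/-- An initial segment with `s` elements is the set of the `s` smallest edges. -/
theorem smallestEdges_eq_of_forall_lt {E : Type*} [Finite E] (ord : LinearOrder E) {A : Set E}
    (hA : ∀ a ∈ A, ∀ b, b ∉ A → ord.lt a b) : smallestEdges ord A.ncard = A := by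
  ext e
  constructor
  · intro he
    by_contra heA
    have hsub : insert e A ⊆ {x | ord.le x e} := by
      rintro x (rfl | hx)
      · exact ord.le_refl _
      · exact ((ord.lt_iff_le_not_ge _ _).mp (hA x hx e heA)).1
    have h₁ := Set.ncard_le_ncard hsub (Set.toFinite _)
    rw [Set.ncard_insert_of_notMem heA (Set.toFinite _)] at h₁
    have h₂ : {x | ord.le x e}.ncard ≤ A.ncard := he
    omega
  · intro he
    refine Set.ncard_le_ncard (fun x hx => ?_) (Set.toFinite _)
    by_contra hxA
    exact ((ord.lt_iff_le_not_ge _ _).mp (hA e he x hxA)).2 hx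

theorem ReachableVia.append_edge {V E : Type*} {src tgt : E → V} {A : Set E} {u : V} {e : E}
    (h : ReachableVia src tgt A u (src e)) (he : e ∈ A) : ReachableVia src tgt A u (tgt e) := by
  obtain ⟨p, hpA, hne, hchain, hhead, hlast⟩ := h
  refine ⟨p ++ [e], ?_, by simp, ?_, ?_, by simp⟩
  · intro x hx
    rcases List.mem_append.mp hx with hx | hx
    · exact hpA x hx
    · rwa [List.mem_singleton.mp hx]
  · refine List.isChain_append.mpr ⟨hchain, List.isChain_singleton _, ?_⟩
    intro x hx y hy
    rw [Option.mem_def.mp hx] at hlast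
    simp_all
  · rwa [List.head?_append_of_ne_nil _ hne]

theorem IsGlobalAttractor.tgt_of_src {V E : Type*} {src tgt : E → V} {A : Set E} {e : E}
    (h : IsGlobalAttractor src tgt A (src e)) (he : e ∈ A) :
    IsGlobalAttractor src tgt A (tgt e) := by
  intro u _
  by_cases hu : u = src e
  · subst hu
    exact ⟨[e], by simpa using he, by simp, List.isChain_singleton _, by simp, by simp⟩
  · exact (h u hu).append_edge he

theorem IsRouting.tgt_eq_src_of_dep {V E : Type*} {src tgt : E → V}
    {route : ∀ u w : V, u ≠ w → List E} (hroute : IsRouting src tgt route) {e₁ e₂ : E}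
    (h : Dep route e₁ e₂) : tgt e₁ = src e₂ := by
  obtain ⟨u, w, huw, hinf⟩ := h
  have hchain : (route u w huw).IsChain (fun a b => tgt a = src b) := (hroute u w huw).2.1
  simpa using hchain.infix hinf

/-- Any linear order can be refined by a rank function: compare ranks first, and break ties
with the given order. -/
theorem exists_linearOrder_rank_lex {E : Type*} (ord : LinearOrder E) (k : E → ℕ) :
    ∃ ord' : LinearOrder E,
      (∀ a b, ord'.le a b ↔ k a < k b ∨ k a = k b ∧ ord.le a b) ∧
      (∀ a b, ord'.lt a b ↔ k a < k b ∨ k a = k b ∧ ord.lt a b) := by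
  let f : E → ℕ ×ₗ E := fun e => toLex (k e, e)
  have hf : Function.Injective f := fun a b h => congrArg (fun x => (ofLex x).2) h
  exact ⟨LinearOrder.lift' f hf, fun _ _ => Prod.Lex.toLex_le_toLex,
    fun _ _ => Prod.Lex.toLex_lt_toLex⟩

/-- Reordering lemma: given a routing-respecting linear order, the `s` smallest edges
can be reordered so that the edges of `E_s` not joining two global attractors of
`G_s = (V, E_s)` come first, followed by the edges of `E_s` joining two global
attractors, with relative order inside each block and the order (and position) of the
remaining edges unchanged; the resulting linear order still respects the routing
scheme. -/
theorem reorder_prefix_respecting_routing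
    {V E : Type*} [Fintype V] [Nonempty V] [Fintype E] (src tgt : E → V)
    (hloop : ∀ e : E, src e ≠ tgt e) (hconn : StronglyConnected src tgt)
    (route : ∀ u w : V, u ≠ w → List E) (hroute : IsRouting src tgt route)
    (ord : LinearOrder E) (hresp : RespectsRouting route ord)
    (s : ℕ) (hs₁ : 1 ≤ s) (hs₂ : s ≤ Fintype.card E)
    (R : Set V)
    (hR : R = {v : V | IsGlobalAttractor src tgt (smallestEdges ord s) v})
    (C₁ C₂ : Set E)
    (hC₂ : C₂ = {e ∈ smallestEdges ord s | src e ∈ R ∧ tgt e ∈ R})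
    (hC₁ : C₁ = smallestEdges ord s \ C₂) :
    ∃ ord' : LinearOrder E,
      RespectsRouting route ord' ∧
      (∀ e₁ e₂ : E, e₁ ∉ smallestEdges ord s → e₂ ∉ smallestEdges ord s →
        (ord'.le e₁ e₂ ↔ ord.le e₁ e₂)) ∧
      (∀ e₁ ∈ smallestEdges ord s, ∀ (e₂ : E), e₂ ∉ smallestEdges ord s →
        ord'.lt e₁ e₂) ∧
      smallestEdges ord' s = smallestEdges ord s ∧
      (∀ e₁ ∈ C₁, ∀ e₂ ∈ C₂, ord'.lt e₁ e₂) ∧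
      (∀ e₁ ∈ C₁, ∀ e₂ ∈ C₁, (ord'.le e₁ e₂ ↔ ord.le e₁ e₂)) ∧
      (∀ e₁ ∈ C₂, ∀ e₂ ∈ C₂, (ord'.le e₁ e₂ ↔ ord.le e₁ e₂)) := by
  classical
  let k : E → ℕ := fun e => if e ∈ smallestEdges ord s then (if e ∈ C₂ then 1 else 0) else 2
  have hsub : ∀ e ∈ C₂, e ∈ smallestEdges ord s := fun e he => by
    rw [hC₂] at he
    exact he.1
  have k_C₁ : ∀ e ∈ C₁, k e = 0 := fun e he => by
    rw [hC₁] at he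
    simp [k, he.1, he.2]
  have k_C₂ : ∀ e ∈ C₂, k e = 1 := fun e he => by simp [k, he, hsub e he]
  have k_out : ∀ e, e ∉ smallestEdges ord s → k e = 2 := fun e he => by simp [k, he]
  have k_in : ∀ e ∈ smallestEdges ord s, k e < 2 := fun e he => by
    simp only [k, he, if_true]
    split_ifs <;> omega
  obtain ⟨ord', hle, hlt⟩ := exists_linearOrder_rank_lex ord k
  have hle_of_eq : ∀ a b, k a = k b → (ord'.le a b ↔ ord.le a b) := fun a b h => by
    simp [hle, h]
  have hbelow : ∀ e₁ ∈ smallestEdges ord s, ∀ e₂, e₂ ∉ smallestEdges ord s → ord'.lt e₁ e₂ :=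
    fun e₁ h₁ e₂ h₂ => (hlt _ _).mpr (Or.inl (by rw [k_out e₂ h₂]; exact k_in e₁ h₁))
  refine ⟨ord', ?_, ?_, hbelow, ?_, ?_, ?_, ?_⟩
  · intro e₁ e₂ hdep
    have hlt₁₂ := hresp e₁ e₂ hdep
    suffices hk : k e₁ ≤ k e₂ from
      (hlt _ _).mpr (hk.lt_or_eq.imp_right fun h => ⟨h, hlt₁₂⟩)
    by_cases h₂ : e₂ ∈ smallestEdges ord s
    · have h₁ : e₁ ∈ smallestEdges ord s :=
        mem_smallestEdges_of_le ord ((ord.lt_iff_le_not_ge _ _).mp hlt₁₂).1 h₂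
      by_cases hc₁ : e₁ ∈ C₂
      · have hc₂ : e₂ ∈ C₂ := by
          rw [hC₂, hR] at hc₁ ⊢
          have hsrc := hc₁.2.2
          rw [hroute.tgt_eq_src_of_dep hdep] at hsrc
          exact ⟨h₂, hsrc, IsGlobalAttractor.tgt_of_src hsrc h₂⟩
        rw [k_C₂ _ hc₁, k_C₂ _ hc₂]
      · simp [k, h₁, hc₁]
    · rw [k_out e₂ h₂]
      by_cases h₁ : e₁ ∈ smallestEdges ord s
      · exact (k_in e₁ h₁).le
      · exact (k_out e₁ h₁).le
  · exact fun e₁ e₂ h₁ h₂ => hle_of_eq _ _ ((k_out e₁ h₁).trans (k_out e₂ h₂).symm)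
  · have h := smallestEdges_eq_of_forall_lt ord' hbelow
    rwa [ncard_smallestEdges ord hs₂] at h
  · intro e₁ h₁ e₂ h₂
    exact (hlt _ _).mpr (Or.inl (by rw [k_C₁ e₁ h₁, k_C₂ e₂ h₂]; exact Nat.zero_lt_one))
  · exact fun e₁ h₁ e₂ h₂ => hle_of_eq _ _ ((k_C₁ e₁ h₁).trans (k_C₁ e₂ h₂).symm)
  · exact fun e₁ h₁ e₂ h₂ => hle_of_eq _ _ ((k_C₂ e₁ h₁).trans (k_C₂ e₂ h₂).symm)
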